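/- arXiv:2011.10383 — 2 statements merged into one kernel-verified Lean document; each statement's English description precedes it below -/
import Mathlib

section
/- The cut rule — from Γ₁ ⇒ φ and φ, Γ₂ ⇒ Δ infer Γ₁, Γ₂ ⇒ Δ — is admissible in G4iSL□ᵃ: if both premises are derivable in G4iSL□ᵃ, then so is the conclusion. -/
/-- Formulas of propositional intuitionistic modal logic. -/
inductive Form : Type
  | atom : ℕ → Form
  | bot : Form
  | and : Form → Form → Form
  | or : Form → Form → Form
  | imp : Form → Form → Form
  | box : Form → Form
  deriving DecidableEq

/-- □Γ : box every formula in the multiset. -/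
def boxM (Γ : Multiset Form) : Multiset Form := Γ.map Form.box

/-- ⊡Γ = Γ ∪ □Γ (multiset union = sum). -/
def boxdot (Γ : Multiset Form) : Multiset Form := Γ + boxM Γ

/-- The multiset contains no boxed formulas. -/
def NoBox (P : Multiset Form) : Prop := ∀ φ ∈ P, ∀ ψ : Form, φ ≠ Form.box ψ

/-- The sequent calculus G4iSL□ᵃ. -/
inductive G4a : Multiset Form → Option Form → Prop
  | axAt {Γ : Multiset Form} {p : ℕ} :
      G4a (Form.atom p ::ₘ Γ) (some (Form.atom p))
  | axBot {Γ : Multiset Form} {Δ : Option Form} :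
      G4a (Form.bot ::ₘ Γ) Δ
  | rAnd {Γ : Multiset Form} {φ ψ : Form} :
      G4a Γ (some φ) → G4a Γ (some ψ) → G4a Γ (some (Form.and φ ψ))
  | lAnd {Γ : Multiset Form} {φ ψ : Form} {Δ : Option Form} :
      G4a (φ ::ₘ ψ ::ₘ Γ) Δ → G4a (Form.and φ ψ ::ₘ Γ) Δ
  | rOrL {Γ : Multiset Form} {φ ψ : Form} :
      G4a Γ (some φ) → G4a Γ (some (Form.or φ ψ))
  | rOrR {Γ : Multiset Form} {φ ψ : Form} :
      G4a Γ (some ψ) → G4a Γ (some (Form.or φ ψ))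
  | lOr {Γ : Multiset Form} {φ ψ : Form} {Δ : Option Form} :
      G4a (φ ::ₘ Γ) Δ → G4a (ψ ::ₘ Γ) Δ → G4a (Form.or φ ψ ::ₘ Γ) Δ
  | rImp {Γ : Multiset Form} {φ ψ : Form} :
      G4a (φ ::ₘ Γ) (some ψ) → G4a Γ (some (Form.imp φ ψ))
  | lAtImp {Γ : Multiset Form} {p : ℕ} {φ : Form} {Δ : Option Form} :
      G4a (Form.atom p ::ₘ φ ::ₘ Γ) Δ →
      G4a (Form.atom p ::ₘ Form.imp (Form.atom p) φ ::ₘ Γ) Δ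
  | lAndImp {Γ : Multiset Form} {φ ψ χ : Form} {Δ : Option Form} :
      G4a (Form.imp φ (Form.imp ψ χ) ::ₘ Γ) Δ →
      G4a (Form.imp (Form.and φ ψ) χ ::ₘ Γ) Δ
  | lOrImp {Γ : Multiset Form} {φ ψ χ : Form} {Δ : Option Form} :
      G4a (Form.imp φ χ ::ₘ Form.imp ψ χ ::ₘ Γ) Δ →
      G4a (Form.imp (Form.or φ ψ) χ ::ₘ Γ) Δ
  | lImpImpA {Γ : Multiset Form} {φ ψ χ : Form} {Δ : Option Form} :
      G4a (φ ::ₘ Form.imp ψ χ ::ₘ Γ) (some ψ) →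
      G4a (χ ::ₘ Γ) Δ →
      G4a (Form.imp (Form.imp φ ψ) χ ::ₘ Γ) Δ
  | impSL1 {P Γ : Multiset Form} {φ ψ : Form} {Δ : Option Form} :
      NoBox P → Form.box φ ∉ boxM Γ →
      G4a (Form.imp (Form.box φ) ψ ::ₘ Form.box φ ::ₘ (P + boxdot Γ)) (some φ) →
      G4a (ψ ::ₘ (P + boxM Γ)) Δ →
      G4a (Form.imp (Form.box φ) ψ ::ₘ (P + boxM Γ)) Δ
  | impSL2 {P Γ : Multiset Form} {φ ψ : Form} {Δ : Option Form} :
      NoBox P → Form.box φ ∈ boxM Γ →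
      G4a (ψ ::ₘ (P + boxM Γ)) Δ →
      G4a (Form.imp (Form.box φ) ψ ::ₘ (P + boxM Γ)) Δ
  | rSLa {P Γ : Multiset Form} {φ : Form} :
      NoBox P →
      G4a (Form.box φ ::ₘ (P + boxdot Γ)) (some φ) →
      G4a (P + boxM Γ) (some (Form.box φ))

/-! ### Kripke trees -/

/-- Well-founded Kripke trees. Each edge carries a flag saying whether it is modal. -/
inductive KTree : Type 1
  | node (ι : Type) (child : ι → KTree) (modal : ι → Prop) (val : ℕ → Prop) : KTree

namespace KTree

/-- The valuation at the root. -/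
def val : KTree → ℕ → Prop
  | node _ _ _ v => v

/-- The intuitionistic order: `Le t u` says that `u` is a subtree of `t`. -/
inductive Le : KTree → KTree → Prop
  | refl (t : KTree) : Le t t
  | step {ι : Type} {c : ι → KTree} {m : ι → Prop} {v : ℕ → Prop} {u : KTree} (i : ι) :
      Le (c i) u → Le (node ι c m v) u

/-- The modal relation: the path from `t` to `u` has at least one modal edge. -/
inductive Rel : KTree → KTree → Prop
  | modal {ι : Type} {c : ι → KTree} {m : ι → Prop} {v : ℕ → Prop} {u : KTree} (i : ι) :
      m i → Le (c i) u → Rel (node ι c m v) u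
  | step {ι : Type} {c : ι → KTree} {m : ι → Prop} {v : ℕ → Prop} {u : KTree} (i : ι) :
      Rel (c i) u → Rel (node ι c m v) u

theorem Le.trans {t u s : KTree} (h : Le t u) (h' : Le u s) : Le t s := by
  induction h with
  | refl => exact h'
  | step i _ ih => exact .step i (ih h')

theorem Rel.le {t u : KTree} (h : Rel t u) : Le t u := by
  induction h with
  | modal i _ h => exact .step i h
  | step i _ ih => exact .step i ih

theorem Le.trans_rel {t u s : KTree} (h : Le t u) (h' : Rel u s) : Rel t s := by
  induction h with
  | refl => exact h'
  | step i _ ih => exact .step i (ih h')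

/-- Löb induction along the modal relation. -/
theorem rel_induction (p : KTree → Prop) (t : KTree)
    (h : ∀ u, Rel t u → (∀ s, Rel u s → p s) → p u) : ∀ u, Rel t u → p u := by
  induction t with
  | node ι c m v ih =>
    have hc : ∀ i u, Rel (c i) u → p u := fun i =>
      ih i fun u hu => h u (.step i hu)
    intro u hu
    cases hu with
    | modal i hm hle => exact h u (.modal i hm hle) fun s hs => hc i s (hle.trans_rel hs)
    | step i hr => exact hc i u hr

/-- Forcing at the root of a tree. -/
def Forces : KTree → Form → Prop
  | t, .atom p => ∀ u, Le t u → u.val p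
  | _, .bot => False
  | t, .and φ ψ => Forces t φ ∧ Forces t ψ
  | t, .or φ ψ => Forces t φ ∨ Forces t ψ
  | t, .imp φ ψ => ∀ u, Le t u → Forces u φ → Forces u ψ
  | t, .box φ => ∀ u, Rel t u → Forces u φ

theorem Forces.mono {φ : Form} {t u : KTree} (h : Forces t φ) (hle : Le t u) :
    Forces u φ := by
  induction φ with
  | atom p => exact fun s hs => h s (hle.trans hs)
  | bot => exact h
  | and φ ψ ihφ ihψ => exact ⟨ihφ h.1, ihψ h.2⟩
  | or φ ψ ihφ ihψ => exact h.imp ihφ ihψ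
  | imp φ ψ => exact fun s hs => h s (hle.trans hs)
  | box φ => exact fun s hs => h s (hle.trans_rel hs)

theorem Forces.mp {φ ψ : Form} {t : KTree} (h : Forces t (.imp φ ψ)) (h' : Forces t φ) :
    Forces t ψ :=
  h t (.refl t) h'

theorem forces_box_of_loeb {φ : Form} {t : KTree}
    (h : ∀ u, Rel t u → Forces u (.box φ) → Forces u φ) : Forces t (.box φ) :=
  rel_induction (fun u => Forces u φ) t h

/-- All formulas of a multiset are forced. -/
def ForcesAll (t : KTree) (Γ : Multiset Form) : Prop := ∀ φ ∈ Γ, Forces t φ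

theorem ForcesAll.mono {Γ : Multiset Form} {t u : KTree} (h : ForcesAll t Γ) (hle : Le t u) :
    ForcesAll u Γ := fun φ hφ => (h φ hφ).mono hle

@[simp] theorem forcesAll_cons {Γ : Multiset Form} {φ : Form} {t : KTree} :
    ForcesAll t (φ ::ₘ Γ) ↔ Forces t φ ∧ ForcesAll t Γ := by
  simp [ForcesAll]

@[simp] theorem forcesAll_add {Γ Γ' : Multiset Form} {t : KTree} :
    ForcesAll t (Γ + Γ') ↔ ForcesAll t Γ ∧ ForcesAll t Γ' := by
  simp only [ForcesAll, Multiset.mem_add]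
  exact ⟨fun h => ⟨fun φ hφ => h φ (.inl hφ), fun φ hφ => h φ (.inr hφ)⟩,
    fun h φ hφ => hφ.elim (h.1 φ) (h.2 φ)⟩

@[simp] theorem forcesAll_boxdot {Γ : Multiset Form} {t : KTree} :
    ForcesAll t (boxdot Γ) ↔ ForcesAll t Γ ∧ ForcesAll t (boxM Γ) :=
  forcesAll_add

theorem ForcesAll.of_boxM {Γ : Multiset Form} {t u : KTree} (h : ForcesAll t (boxM Γ))
    (hr : Rel t u) : ForcesAll u Γ := fun φ hφ =>
  h (.box φ) (Multiset.mem_map_of_mem _ hφ) u hr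

end KTree

open KTree in
theorem G4a.sound {Γ : Multiset Form} {Δ : Option Form} (h : G4a Γ Δ) :
    ∀ t : KTree, ForcesAll t Γ → ∃ δ ∈ Δ, Forces t δ := by
  induction h with
  | axAt => exact fun t h => ⟨_, rfl, (forcesAll_cons.1 h).1⟩
  | axBot => exact fun t h => ((forcesAll_cons.1 h).1 : False).elim
  | rAnd _ _ ih₁ ih₂ =>
    intro t h
    have h₁ := ih₁ t h
    have h₂ := ih₂ t h
    simp only [Option.mem_some_iff, exists_eq_left'] at h₁ h₂ ⊢
    exact ⟨h₁, h₂⟩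
  | lAnd _ ih =>
    intro t h
    rw [forcesAll_cons] at h
    exact ih t (by simpa using ⟨h.1.1, h.1.2, h.2⟩)
  | rOrL _ ih =>
    intro t h
    have h₁ := ih t h
    simp only [Option.mem_some_iff, exists_eq_left'] at h₁ ⊢
    exact .inl h₁
  | rOrR _ ih =>
    intro t h
    have h₁ := ih t h
    simp only [Option.mem_some_iff, exists_eq_left'] at h₁ ⊢
    exact .inr h₁
  | lOr _ _ ih₁ ih₂ =>
    intro t h
    rw [forcesAll_cons] at h
    rcases h.1 with h' | h'
    · exact ih₁ t (forcesAll_cons.2 ⟨h', h.2⟩)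
    · exact ih₂ t (forcesAll_cons.2 ⟨h', h.2⟩)
  | rImp _ ih =>
    intro t h
    refine ⟨_, rfl, fun u hu hφ => ?_⟩
    simpa using ih u (forcesAll_cons.2 ⟨hφ, h.mono hu⟩)
  | lAtImp _ ih =>
    intro t h
    simp only [forcesAll_cons] at h
    exact ih t (by simpa using ⟨h.1, h.2.1.mp h.1, h.2.2⟩)
  | lAndImp _ ih =>
    intro t h
    rw [forcesAll_cons] at h
    refine ih t (forcesAll_cons.2 ⟨fun u hu hφ s hs hψ => ?_, h.2⟩)
    exact h.1 s (hu.trans hs) ⟨hφ.mono hs, hψ⟩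
  | lOrImp _ ih =>
    intro t h
    rw [forcesAll_cons] at h
    refine ih t (forcesAll_cons.2 ⟨fun u hu hφ => ?_,
      forcesAll_cons.2 ⟨fun u hu hψ => ?_, h.2⟩⟩)
    · exact h.1 u hu (.inl hφ)
    · exact h.1 u hu (.inr hψ)
  | @lImpImpA Γ φ ψ χ Δ _ _ ih₁ ih₂ =>
    intro t h
    rw [forcesAll_cons] at h
    have hi : Forces t (.imp φ ψ) := fun u hu hφ => by
      have hχ : Forces u (.imp ψ χ) := fun s hs hψ =>
        h.1 s (hu.trans hs) fun r hr _ => hψ.mono hr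
      simpa using ih₁ u (forcesAll_cons.2 ⟨hφ, forcesAll_cons.2 ⟨hχ, h.2.mono hu⟩⟩)
    exact ih₂ t (forcesAll_cons.2 ⟨h.1.mp hi, h.2⟩)
  | @impSL1 P Γ φ ψ Δ _ _ _ _ ih₁ ih₂ =>
    intro t h
    rw [forcesAll_cons, forcesAll_add] at h
    have hb : Forces t (.box φ) := forces_box_of_loeb fun u hu hφ => by
      simpa using ih₁ u (by
        simpa using ⟨h.1.mono hu.le, hφ, h.2.1.mono hu.le, h.2.2.of_boxM hu,
          h.2.2.mono hu.le⟩)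
    exact ih₂ t (by simpa using ⟨h.1.mp hb, h.2⟩)
  | @impSL2 P Γ φ ψ Δ _ hφ _ ih =>
    intro t h
    rw [forcesAll_cons, forcesAll_add] at h
    exact ih t (by simpa using ⟨h.1.mp (h.2.2 _ hφ), h.2⟩)
  | rSLa _ _ ih =>
    intro t h
    rw [forcesAll_add] at h
    refine ⟨_, rfl, forces_box_of_loeb fun u hu hφ => ?_⟩
    simpa using ih u (by
      simpa using ⟨hφ, h.1.mono hu.le, h.2.of_boxM hu, h.2.mono hu.le⟩)

/-! ### Identity sequents -/

theorem exists_noBox_add_boxM (Γ : Multiset Form) :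
    ∃ P G : Multiset Form, NoBox P ∧ Γ = P + boxM G := by
  induction Γ using Multiset.induction with
  | empty => exact ⟨0, 0, by simp [NoBox], by simp [boxM]⟩
  | cons φ Γ ih =>
    obtain ⟨P, G, hP, rfl⟩ := ih
    by_cases h : ∃ ψ, φ = .box ψ
    · obtain ⟨ψ, rfl⟩ := h
      exact ⟨P, ψ ::ₘ G, hP, by simp [boxM]⟩
    · refine ⟨φ ::ₘ P, G, ?_, by simp⟩
      intro χ hχ ψ
      rcases Multiset.mem_cons.1 hχ with rfl | hχ
      · exact fun e => h ⟨ψ, e⟩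
      · exact hP χ hχ ψ

theorem box_mem_add_boxM {P G : Multiset Form} (hP : NoBox P) {φ : Form} :
    Form.box φ ∈ P + boxM G ↔ φ ∈ G := by
  simp only [Multiset.mem_add, boxM, Multiset.mem_map, Form.box.injEq, exists_eq_right,
    or_iff_right_iff_imp]
  exact fun h => (hP _ h φ rfl).elim

theorem G4a.identity_and_modusPonens (φ : Form) :
    (∀ Γ, φ ∈ Γ → G4a Γ (some φ)) ∧
      ∀ (ψ : Form) (Θ : Multiset Form) (Δ : Option Form),
        (∀ Γ, Θ ≤ Γ → G4a (ψ ::ₘ Γ) Δ) → ∀ Γ, Θ ≤ Γ → G4a (φ ::ₘ .imp φ ψ ::ₘ Γ) Δ := by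
  induction φ with
  | atom p =>
    refine ⟨fun Γ h => ?_, fun ψ Θ Δ h Γ hΓ => ?_⟩
    · obtain ⟨Γ, rfl⟩ := Multiset.exists_cons_of_mem h
      exact .axAt
    · refine .lAtImp ?_
      rw [Multiset.cons_swap]
      exact h _ (hΓ.trans (Multiset.le_cons_self _ _))
  | bot =>
    refine ⟨fun Γ h => ?_, fun ψ Θ Δ h Γ hΓ => .axBot⟩
    obtain ⟨Γ, rfl⟩ := Multiset.exists_cons_of_mem h
    exact .axBot
  | and α β ihα ihβ =>
    refine ⟨fun Γ h => ?_, fun ψ Θ Δ h Γ hΓ => ?_⟩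
    · obtain ⟨Γ, rfl⟩ := Multiset.exists_cons_of_mem h
      exact .lAnd (.rAnd (ihα.1 _ (by simp)) (ihβ.1 _ (by simp)))
    · refine .lAnd ?_
      rw [Multiset.cons_swap β, Multiset.cons_swap α]
      refine .lAndImp ?_
      rw [Multiset.cons_swap _ α]
      refine ihα.2 (.imp β ψ) (β ::ₘ Θ) Δ (fun Γ' hΓ' => ?_) _
        (Multiset.cons_le_cons β hΓ)
      obtain ⟨Γ'', rfl⟩ := Multiset.exists_cons_of_mem
        (Multiset.mem_of_le hΓ' (Multiset.mem_cons_self _ _))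
      rw [Multiset.cons_swap]
      exact ihβ.2 ψ Θ Δ h Γ'' ((Multiset.cons_le_cons_iff β).1 hΓ')
  | or α β ihα ihβ =>
    refine ⟨fun Γ h => ?_, fun ψ Θ Δ h Γ hΓ => ?_⟩
    · obtain ⟨Γ, rfl⟩ := Multiset.exists_cons_of_mem h
      exact .lOr (.rOrL (ihα.1 _ (by simp))) (.rOrR (ihβ.1 _ (by simp)))
    · refine .lOr ?_ ?_ <;> rw [Multiset.cons_swap] <;> refine .lOrImp ?_
      · rw [Multiset.cons_swap _ α, Multiset.cons_swap _ α]
        exact ihα.2 ψ Θ Δ h _ (hΓ.trans (Multiset.le_cons_self _ _))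
      · rw [Multiset.cons_swap _ β, Multiset.cons_swap _ β,
          Multiset.cons_swap (Form.imp α ψ)]
        exact ihβ.2 ψ Θ Δ h _ (hΓ.trans (Multiset.le_cons_self _ _))
  | imp α β ihα ihβ =>
    refine ⟨fun Γ h => ?_, fun ψ Θ Δ h Γ hΓ => ?_⟩
    · obtain ⟨Γ, rfl⟩ := Multiset.exists_cons_of_mem h
      exact .rImp (ihα.2 β 0 _ (fun Γ _ => ihβ.1 _ (by simp)) Γ (Multiset.zero_le _))
    · rw [Multiset.cons_swap]
      refine .lImpImpA ?_ (h _ (hΓ.trans (Multiset.le_cons_self _ _)))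
      rw [Multiset.cons_swap (Form.imp β ψ)]
      exact ihα.2 β 0 _ (fun Γ _ => ihβ.1 _ (by simp)) _ (Multiset.zero_le _)
  | box α ihα =>
    refine ⟨fun Γ h => ?_, fun ψ Θ Δ h Γ hΓ => ?_⟩
    · obtain ⟨P, G, hP, rfl⟩ := exists_noBox_add_boxM Γ
      rw [box_mem_add_boxM hP] at h
      exact .rSLa hP (ihα.1 _ (by simp [boxdot, h]))
    · rw [Multiset.cons_swap]
      have h' := h (.box α ::ₘ Γ) (hΓ.trans (Multiset.le_cons_self _ _))
      have hm : Form.box α ∈ Form.box α ::ₘ Γ := Multiset.mem_cons_self _ _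
      generalize Form.box α ::ₘ Γ = Γ' at h' hm
      obtain ⟨P, G, hP, rfl⟩ := exists_noBox_add_boxM Γ'
      rw [box_mem_add_boxM hP] at hm
      exact .impSL2 hP (Multiset.mem_map_of_mem _ hm) h'

theorem G4a.of_mem {Γ : Multiset Form} {φ : Form} (h : φ ∈ Γ) : G4a Γ (some φ) :=
  (G4a.identity_and_modusPonens φ).1 Γ h

/-! ### A terminating measure on sequents -/

namespace Form

/-- The weight of a formula. -/
def weight : Form → ℕ
  | atom _ => 1
  | bot => 1
  | and φ ψ => φ.weight + ψ.weight + 2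
  | or φ ψ => φ.weight + ψ.weight + 1
  | imp φ ψ => φ.weight + ψ.weight + 1
  | box φ => φ.weight + 1

theorem weight_pos (φ : Form) : 0 < φ.weight := by
  cases φ <;> simp [weight]

/-- The formulas that occur directly below a box. -/
def boxed : Form → Finset Form
  | atom _ => ∅
  | bot => ∅
  | and φ ψ => φ.boxed ∪ ψ.boxed
  | or φ ψ => φ.boxed ∪ ψ.boxed
  | imp φ ψ => φ.boxed ∪ ψ.boxed
  | box φ => insert φ φ.boxed

end Form

/-- The weight of a sequent. -/
def seqWeight (Γ : Multiset Form) (Δ : Option Form) : ℕ :=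
  (Γ.map fun φ => 4 ^ φ.weight).sum + Δ.elim 0 fun φ => 4 ^ φ.weight

/-- The number of formulas of `X` whose box is absent from the antecedent. -/
def missing (X : Finset Form) (Γ : Multiset Form) : ℕ :=
  (X.filter fun φ => Form.box φ ∉ Γ).card

/-- All formulas below a box in the sequent belong to `X`. -/
def BoxedIn (X : Finset Form) (Γ : Multiset Form) (Δ : Option Form) : Prop :=
  (∀ φ ∈ Γ, φ.boxed ⊆ X) ∧ ∀ φ ∈ Δ, φ.boxed ⊆ X

theorem boxed_subset_of_boxdot {X : Finset Form} {P G : Multiset Form}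
    (h : ∀ φ ∈ P + boxM G, φ.boxed ⊆ X) : ∀ φ ∈ P + boxdot G, φ.boxed ⊆ X := by
  intro φ hφ
  simp only [boxdot, Multiset.mem_add] at h hφ
  rcases hφ with hφ | hφ | hφ
  · exact h φ (.inl hφ)
  · exact (Finset.subset_insert φ φ.boxed).trans
      (h (.box φ) (.inr (Multiset.mem_map_of_mem _ hφ)))
  · exact h φ (.inr hφ)

theorem four_pow_add_lt {a b c n : ℕ} (ha : a < n) (hb : b < n) (hc : c < n) :
    4 ^ a + 4 ^ b + 4 ^ c < 4 ^ n := by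
  obtain ⟨n, rfl⟩ : ∃ m, n = m + 1 := ⟨n - 1, by omega⟩
  have h : ∀ {k}, k < n + 1 → 4 ^ k ≤ 4 ^ n := fun hk =>
    Nat.pow_le_pow_right (by norm_num) (by omega)
  have h₁ := h ha
  have h₂ := h hb
  have h₃ := h hc
  have h₄ : 0 < 4 ^ n := by positivity
  rw [pow_succ]
  omega

theorem four_pow_add_lt' {a b n : ℕ} (ha : a < n) (hb : b < n) : 4 ^ a + 4 ^ b < 4 ^ n :=
  (Nat.le_add_right _ _).trans_lt (four_pow_add_lt ha hb hb)

theorem four_pow_lt {a n : ℕ} (ha : a < n) : 4 ^ a < 4 ^ n :=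
  Nat.pow_lt_pow_right (by norm_num) ha

theorem missing_le {X : Finset Form} {Γ Γ' : Multiset Form}
    (h : ∀ φ, Form.box φ ∈ Γ → Form.box φ ∈ Γ') : missing X Γ' ≤ missing X Γ :=
  Finset.card_le_card (Finset.monotone_filter_right X fun φ _ hφ => mt (h φ) hφ)

theorem missing_lt {X : Finset Form} {Γ Γ' : Multiset Form} {φ : Form}
    (h : ∀ φ, Form.box φ ∈ Γ → Form.box φ ∈ Γ') (hX : φ ∈ X) (hφ : Form.box φ ∉ Γ)
    (hmem : Form.box φ ∈ Γ') : missing X Γ' < missing X Γ := by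
  refine Finset.card_lt_card ((Finset.ssubset_iff_of_subset
    (Finset.monotone_filter_right X fun φ _ hφ => mt (h φ) hφ)).2 ⟨φ, ?_, ?_⟩)
  · simp [hX, hφ]
  · simp [hmem]

/-! ### Completeness -/

open KTree

/-- The sequent is refuted at the root of some Kripke tree. -/
def Refutable (Γ : Multiset Form) (Δ : Option Form) : Prop :=
  ∃ t : KTree, ForcesAll t Γ ∧ ∀ δ ∈ Δ, ¬ Forces t δ

/-- The immediate subtrees allowed in a tree that is to force `Γ`. -/
def GoodChild (Γ : Multiset Form) (m : Prop) (t : KTree) : Prop :=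
  ForcesAll t Γ ∧ (m → ∀ φ, Form.box φ ∈ Γ → Forces t φ)

/-- A tree whose immediate subtrees refute everything that good children can refute. -/
theorem exists_root (Γ : Multiset Form) : ∃ r : KTree,
    (∀ p, r.val p ↔ Form.atom p ∈ Γ) ∧
    (∀ u, Le r u → u = r ∨ ForcesAll u Γ) ∧
    (∀ u, Rel r u → ∀ φ, Form.box φ ∈ Γ → Forces u φ) ∧
    (∀ m t φ, GoodChild Γ m t → ¬ Forces t φ → ∃ u, Le r u ∧ ForcesAll u Γ ∧ ¬ Forces u φ) ∧
    ∀ t φ, GoodChild Γ True t → ¬ Forces t φ → ¬ Forces r (.box φ) := by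
  let ι := {x : Bool × Form // ∃ t, GoodChild Γ (x.1 = true) t ∧ ¬ Forces t x.2}
  have hι : ∀ i : ι, ∃ t, GoodChild Γ (i.1.1 = true) t ∧ ¬ Forces t i.1.2 := fun i => i.2
  choose c hc hn using hι
  refine ⟨.node ι c (fun i => i.1.1 = true) fun p => .atom p ∈ Γ, fun p => Iff.rfl, ?_, ?_,
    ?_, ?_⟩
  · intro u hu
    cases hu with
    | refl => exact .inl rfl
    | step i h => exact .inr ((hc i).1.mono h)
  · intro u hu φ hφ
    cases hu with
    | modal i hm h => exact ((hc i).2 hm φ hφ).mono h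
    | step i h => exact (hc i).1 _ hφ u h
  · intro m t φ ht hφ
    have i : ∃ i : ι, i.1 = (false, φ) :=
      ⟨⟨(false, φ), t, ⟨ht.1, fun h => by simp at h⟩, hφ⟩, rfl⟩
    obtain ⟨i, hi⟩ := i
    have := hn i
    rw [hi] at this
    exact ⟨c i, .step i (.refl _), (hc i).1, this⟩
  · intro t φ ht hφ hr
    have i : ∃ i : ι, i.1 = (true, φ) :=
      ⟨⟨(true, φ), t, ⟨ht.1, fun _ => ht.2 trivial⟩, hφ⟩, rfl⟩
    obtain ⟨i, hi⟩ := i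
    have := hn i
    rw [hi] at this
    exact this (hr _ (.modal i (by rw [hi]) (.refl _)))

/-- An irreducible sequent whose non-invertible premises are refutable is refutable. -/
theorem refutable_of_irreducible {Γ : Multiset Form} {Δ : Option Form}
    (hbot : Form.bot ∉ Γ)
    (hand : ∀ φ ψ, Form.and φ ψ ∉ Γ)
    (hor : ∀ φ ψ, Form.or φ ψ ∉ Γ)
    (hatImp : ∀ p φ, Form.imp (.atom p) φ ∈ Γ → Form.atom p ∉ Γ)
    (handImp : ∀ φ ψ χ, Form.imp (.and φ ψ) χ ∉ Γ)
    (horImp : ∀ φ ψ χ, Form.imp (.or φ ψ) χ ∉ Γ)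
    (himpImp : ∀ φ ψ χ, Form.imp (.imp φ ψ) χ ∈ Γ →
      ∃ t, ForcesAll t Γ ∧ Forces t φ ∧ ¬ Forces t ψ)
    (hboxImp : ∀ φ ψ, Form.imp (.box φ) ψ ∈ Γ → ∃ t, GoodChild Γ True t ∧ ¬ Forces t φ)
    (hΔatom : ∀ p, Δ = some (.atom p) → Form.atom p ∉ Γ)
    (hΔand : ∀ φ ψ, Δ ≠ some (.and φ ψ))
    (hΔor : ∀ φ ψ, Δ = some (.or φ ψ) → Refutable Γ (some φ) ∧ Refutable Γ (some ψ))
    (hΔimp : ∀ φ ψ, Δ ≠ some (.imp φ ψ))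
    (hΔbox : ∀ φ, Δ = some (.box φ) → ∃ t, GoodChild Γ True t ∧ ¬ Forces t φ) :
    Refutable Γ Δ := by
  obtain ⟨r, hval, hle, hrel, hchild, hmodal⟩ := exists_root Γ
  have hrefute : ∀ φ, Refutable Γ (some φ) → ¬ Forces r φ := by
    rintro φ ⟨t, ht, hφ⟩ hr
    obtain ⟨u, hu, -, hn⟩ := hchild False t φ ⟨ht, False.elim⟩ (hφ φ rfl)
    exact hn (hr.mono hu)
  refine ⟨r, fun φ hφ => ?_, fun δ hδ => ?_⟩
  · cases φ with
    | atom p =>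
      intro u hu
      rcases hle u hu with rfl | h
      · exact (hval p).2 hφ
      · exact h _ hφ u (.refl u)
    | bot => exact (hbot hφ).elim
    | and => exact (hand _ _ hφ).elim
    | or => exact (hor _ _ hφ).elim
    | box φ => exact fun u hu => hrel u hu φ hφ
    | imp φ ψ =>
      intro u hu hf
      rcases hle u hu with rfl | h
      · exfalso
        cases φ with
        | atom p => exact hatImp p ψ hφ ((hval p).1 (hf _ hu))
        | bot => exact hf
        | and => exact handImp _ _ _ hφ
        | or => exact horImp _ _ _ hφ
        | imp α β =>
          obtain ⟨t, ht, hα, hβ⟩ := himpImp _ _ _ hφ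
          refine hrefute (.imp α β) ⟨t, ht, ?_⟩ hf
          rintro _ ⟨⟩ h
          exact hβ (h.mp hα)
        | box α =>
          obtain ⟨t, ht, hα⟩ := hboxImp _ _ hφ
          exact hmodal t α ht hα hf
      · exact (h _ hφ).mp hf
  · obtain rfl : Δ = some δ := hδ
    cases δ with
    | atom p => exact fun h => hΔatom p rfl ((hval p).1 (h r (.refl r)))
    | bot => exact id
    | and => exact (hΔand _ _ rfl).elim
    | or φ ψ =>
      obtain ⟨h₁, h₂⟩ := hΔor _ _ rfl
      exact fun h => h.elim (hrefute φ h₁) (hrefute ψ h₂)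
    | imp => exact (hΔimp _ _ rfl).elim
    | box φ =>
      obtain ⟨t, ht, hα⟩ := hΔbox _ rfl
      exact hmodal t φ ht hα

theorem derivable_or_refutable_of_smaller {X : Finset Form} {Γ : Multiset Form}
    {Δ : Option Form} (hX : BoxedIn X Γ Δ)
    (hweight : ∀ Γ' Δ', BoxedIn X Γ' Δ' → (∀ φ, Form.box φ ∈ Γ → Form.box φ ∈ Γ') →
      seqWeight Γ' Δ' < seqWeight Γ Δ → G4a Γ' Δ' ∨ Refutable Γ' Δ')
    (hmissing : ∀ Γ' Δ' φ, BoxedIn X Γ' Δ' → (∀ φ, Form.box φ ∈ Γ → Form.box φ ∈ Γ') →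
      φ ∈ X → Form.box φ ∉ Γ → Form.box φ ∈ Γ' → G4a Γ' Δ' ∨ Refutable Γ' Δ') :
    G4a Γ Δ ∨ Refutable Γ Δ := by
  by_contra hno
  obtain ⟨hd, hr⟩ := not_or.1 hno
  have hbox2 : ∀ φ ψ, Form.imp (.box φ) ψ ∈ Γ → Form.box φ ∉ Γ := by
    intro φ ψ hm hφ
    obtain ⟨Γ₀, rfl⟩ := Multiset.exists_cons_of_mem hm
    rcases hweight (ψ ::ₘ Γ₀) Δ
      (by
        simp only [BoxedIn, Multiset.forall_mem_cons, Form.boxed, Finset.union_subset_iff]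
          at hX ⊢
        tauto)
      (by simp +contextual)
      (by
        have := four_pow_lt (a := ψ.weight) (n := (Form.imp (.box φ) ψ).weight)
          (by simp only [Form.weight]; omega)
        simp only [seqWeight, Multiset.map_cons, Multiset.sum_cons]
        omega) with h | ⟨t, ht, hΔ⟩
    · obtain ⟨P, G, hP, rfl⟩ := exists_noBox_add_boxM Γ₀
      replace hφ : Form.box φ ∈ P + boxM G := by simpa using hφ
      exact hd (.impSL2 hP (Multiset.mem_map_of_mem _ ((box_mem_add_boxM hP).1 hφ)) h)
    · rw [forcesAll_cons] at ht
      exact hr ⟨t, forcesAll_cons.2 ⟨fun u hu _ => ht.1.mono hu, ht.2⟩, hΔ⟩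
  refine hr (refutable_of_irreducible ?_ ?_ ?_ ?_ ?_ ?_ ?_ ?_ ?_ ?_ ?_ ?_ ?_)
  · intro hm
    obtain ⟨Γ₀, rfl⟩ := Multiset.exists_cons_of_mem hm
    exact hd .axBot
  · intro φ ψ hm
    obtain ⟨Γ₀, rfl⟩ := Multiset.exists_cons_of_mem hm
    rcases hweight (φ ::ₘ ψ ::ₘ Γ₀) Δ
      (by
        simp only [BoxedIn, Multiset.forall_mem_cons, Form.boxed, Finset.union_subset_iff]
          at hX ⊢
        tauto)
      (by simp +contextual)
      (by
        have := four_pow_add_lt' (a := φ.weight) (b := ψ.weight)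
          (n := (Form.and φ ψ).weight)
          (by simp only [Form.weight]; omega) (by simp only [Form.weight]; omega)
        simp only [seqWeight, Multiset.map_cons, Multiset.sum_cons]
        omega) with h | ⟨t, ht, hΔ⟩
    · exact hd (.lAnd h)
    · simp only [forcesAll_cons] at ht
      exact hr ⟨t, forcesAll_cons.2 ⟨⟨ht.1, ht.2.1⟩, ht.2.2⟩, hΔ⟩
  · intro φ ψ hm
    obtain ⟨Γ₀, rfl⟩ := Multiset.exists_cons_of_mem hm
    simp only [BoxedIn, Multiset.forall_mem_cons, Form.boxed, Finset.union_subset_iff] at hX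
    rcases hweight (φ ::ₘ Γ₀) Δ
      (by simp only [BoxedIn, Multiset.forall_mem_cons]; tauto)
      (by simp +contextual)
      (by
        have := four_pow_lt (a := φ.weight) (n := (Form.or φ ψ).weight)
          (by simp only [Form.weight]; omega)
        simp only [seqWeight, Multiset.map_cons, Multiset.sum_cons]
        omega) with h₁ | ⟨t, ht, hΔ⟩
    · rcases hweight (ψ ::ₘ Γ₀) Δ
        (by simp only [BoxedIn, Multiset.forall_mem_cons]; tauto)
        (by simp +contextual)
        (by
          have := four_pow_lt (a := ψ.weight) (n := (Form.or φ ψ).weight)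
            (by simp only [Form.weight]; omega)
          simp only [seqWeight, Multiset.map_cons, Multiset.sum_cons]
          omega) with h₂ | ⟨t, ht, hΔ⟩
      · exact hd (.lOr h₁ h₂)
      · rw [forcesAll_cons] at ht
        exact hr ⟨t, forcesAll_cons.2 ⟨.inr ht.1, ht.2⟩, hΔ⟩
    · rw [forcesAll_cons] at ht
      exact hr ⟨t, forcesAll_cons.2 ⟨.inl ht.1, ht.2⟩, hΔ⟩
  · intro p φ hm hp
    obtain ⟨Γ₀, rfl⟩ := Multiset.exists_cons_of_mem hm
    obtain ⟨Γ₁, rfl⟩ := Multiset.exists_cons_of_mem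
      ((Multiset.mem_cons.1 hp).resolve_left (by simp))
    rcases hweight (.atom p ::ₘ φ ::ₘ Γ₁) Δ
      (by
        simp only [BoxedIn, Multiset.forall_mem_cons, Form.boxed, Finset.union_subset_iff]
          at hX ⊢
        tauto)
      (by simp +contextual)
      (by
        have := four_pow_lt (a := φ.weight) (n := (Form.imp (.atom p) φ).weight)
          (by simp only [Form.weight]; omega)
        simp only [seqWeight, Multiset.map_cons, Multiset.sum_cons]
        omega) with h | ⟨t, ht, hΔ⟩
    · exact hd (Multiset.cons_swap _ _ _ ▸ .lAtImp h)
    · simp only [forcesAll_cons] at ht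
      refine hr ⟨t, ?_, hΔ⟩
      simp only [forcesAll_cons]
      exact ⟨fun u hu _ => ht.2.1.mono hu, ht.1, ht.2.2⟩
  · intro φ ψ χ hm
    obtain ⟨Γ₀, rfl⟩ := Multiset.exists_cons_of_mem hm
    rcases hweight (.imp φ (.imp ψ χ) ::ₘ Γ₀) Δ
      (by
        simp only [BoxedIn, Multiset.forall_mem_cons, Form.boxed, Finset.union_subset_iff]
          at hX ⊢
        tauto)
      (by simp +contextual)
      (by
        have := four_pow_lt (a := (Form.imp φ (.imp ψ χ)).weight)
          (n := (Form.imp (.and φ ψ) χ).weight) (by simp only [Form.weight]; omega)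
        simp only [seqWeight, Multiset.map_cons, Multiset.sum_cons]
        omega) with h | ⟨t, ht, hΔ⟩
    · exact hd (.lAndImp h)
    · rw [forcesAll_cons] at ht
      exact hr ⟨t, forcesAll_cons.2
        ⟨fun u hu h => (ht.1 u hu h.1).mp h.2, ht.2⟩, hΔ⟩
  · intro φ ψ χ hm
    obtain ⟨Γ₀, rfl⟩ := Multiset.exists_cons_of_mem hm
    rcases hweight (.imp φ χ ::ₘ .imp ψ χ ::ₘ Γ₀) Δ
      (by
        simp only [BoxedIn, Multiset.forall_mem_cons, Form.boxed, Finset.union_subset_iff]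
          at hX ⊢
        tauto)
      (by simp +contextual)
      (by
        have := four_pow_add_lt' (a := (Form.imp φ χ).weight) (b := (Form.imp ψ χ).weight)
          (n := (Form.imp (.or φ ψ) χ).weight)
          (by simp only [Form.weight]; have := ψ.weight_pos; omega)
          (by simp only [Form.weight]; have := φ.weight_pos; omega)
        simp only [seqWeight, Multiset.map_cons, Multiset.sum_cons]
        omega) with h | ⟨t, ht, hΔ⟩
    · exact hd (.lOrImp h)
    · simp only [forcesAll_cons] at ht
      exact hr ⟨t, forcesAll_cons.2
        ⟨fun u hu h => h.elim (ht.1 u hu) (ht.2.1 u hu), ht.2.2⟩, hΔ⟩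
  · intro φ ψ χ hm
    obtain ⟨Γ₀, rfl⟩ := Multiset.exists_cons_of_mem hm
    simp only [BoxedIn, Multiset.forall_mem_cons, Form.boxed, Finset.union_subset_iff] at hX
    rcases hweight (χ ::ₘ Γ₀) Δ
      (by simp only [BoxedIn, Multiset.forall_mem_cons]; tauto)
      (by simp +contextual)
      (by
        have := four_pow_lt (a := χ.weight) (n := (Form.imp (.imp φ ψ) χ).weight)
          (by simp only [Form.weight]; omega)
        simp only [seqWeight, Multiset.map_cons, Multiset.sum_cons]
        omega) with h₂ | ⟨t, ht, hΔ⟩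
    · rcases hweight (φ ::ₘ .imp ψ χ ::ₘ Γ₀) (some ψ)
        (by
          simp only [BoxedIn, Multiset.forall_mem_cons, Form.boxed, Finset.union_subset_iff,
            Option.mem_some_iff, forall_eq']
          tauto)
        (by simp +contextual)
        (by
          have := four_pow_add_lt (a := φ.weight) (b := (Form.imp ψ χ).weight)
            (c := ψ.weight) (n := (Form.imp (.imp φ ψ) χ).weight)
            (by simp only [Form.weight]; omega) (by simp only [Form.weight]; omega)
            (by simp only [Form.weight]; omega)
          simp only [seqWeight, Multiset.map_cons, Multiset.sum_cons, Option.elim_some]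
          omega) with h₁ | ⟨t, ht, hψ⟩
      · exact (hd (.lImpImpA h₁ h₂)).elim
      · simp only [forcesAll_cons] at ht
        refine ⟨t, forcesAll_cons.2 ⟨fun u hu h => ?_, ht.2.2⟩, ht.1, hψ ψ rfl⟩
        exact (ht.2.1.mono hu).mp (h.mp (ht.1.mono hu))
    · rw [forcesAll_cons] at ht
      exact (hr ⟨t, forcesAll_cons.2 ⟨fun u hu _ => ht.1.mono hu, ht.2⟩, hΔ⟩).elim
  · intro φ ψ hm
    have hφ := hbox2 φ ψ hm
    obtain ⟨Γ₀, rfl⟩ := Multiset.exists_cons_of_mem hm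
    simp only [BoxedIn, Multiset.forall_mem_cons, Form.boxed, Finset.union_subset_iff,
      Finset.insert_subset_iff] at hX
    rcases hweight (ψ ::ₘ Γ₀) Δ
      (by simp only [BoxedIn, Multiset.forall_mem_cons]; tauto)
      (by simp +contextual)
      (by
        have := four_pow_lt (a := ψ.weight) (n := (Form.imp (.box φ) ψ).weight)
          (by simp only [Form.weight]; omega)
        simp only [seqWeight, Multiset.map_cons, Multiset.sum_cons]
        omega) with h₂ | ⟨t, ht, hΔ⟩
    · obtain ⟨P, G, hP, rfl⟩ := exists_noBox_add_boxM Γ₀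
      have hG := boxed_subset_of_boxdot hX.1.2
      rcases hmissing (.imp (.box φ) ψ ::ₘ .box φ ::ₘ (P + boxdot G)) (some φ) φ
        (by
          simp only [BoxedIn, Multiset.forall_mem_cons, Form.boxed, Finset.union_subset_iff,
            Finset.insert_subset_iff, Option.mem_some_iff, forall_eq']
          tauto)
        (by simp +contextual [boxdot, or_imp])
        hX.1.1.1.1 hφ (by simp) with h₁ | ⟨t, ht, hn⟩
      · refine (hd (.impSL1 hP (fun h => hφ ?_) h₁ h₂)).elim
        simp [h]
      · simp only [forcesAll_cons, forcesAll_add, forcesAll_boxdot] at ht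
        refine ⟨t, ⟨?_, fun _ χ hχ => ?_⟩, hn φ rfl⟩
        · simp only [forcesAll_cons, forcesAll_add]
          tauto
        · exact ht.2.2.2.1 χ ((box_mem_add_boxM hP).1 (by simpa using hχ))
    · rw [forcesAll_cons] at ht
      exact (hr ⟨t, forcesAll_cons.2 ⟨fun u hu _ => ht.1.mono hu, ht.2⟩, hΔ⟩).elim
  · rintro p rfl hp
    exact hd (.of_mem hp)
  · rintro φ ψ rfl
    simp only [BoxedIn, Form.boxed, Finset.union_subset_iff, Option.mem_some_iff,
      forall_eq'] at hX
    rcases hweight Γ (some φ)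
      (by simp only [BoxedIn, Option.mem_some_iff, forall_eq']; tauto) (fun _ h => h)
      (by
        have := four_pow_lt (a := φ.weight) (n := (Form.and φ ψ).weight)
          (by simp only [Form.weight]; omega)
        simp only [seqWeight, Option.elim_some]
        omega) with h₁ | ⟨t, ht, hn⟩
    · rcases hweight Γ (some ψ)
        (by simp only [BoxedIn, Option.mem_some_iff, forall_eq']; tauto) (fun _ h => h)
        (by
          have := four_pow_lt (a := ψ.weight) (n := (Form.and φ ψ).weight)
            (by simp only [Form.weight]; omega)
          simp only [seqWeight, Option.elim_some]
          omega) with h₂ | ⟨t, ht, hn⟩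
      · exact hd (.rAnd h₁ h₂)
      · exact hr ⟨t, ht, by rintro _ ⟨⟩ h; exact hn ψ rfl h.2⟩
    · exact hr ⟨t, ht, by rintro _ ⟨⟩ h; exact hn φ rfl h.1⟩
  · rintro φ ψ rfl
    simp only [BoxedIn, Form.boxed, Finset.union_subset_iff, Option.mem_some_iff,
      forall_eq'] at hX
    constructor
    · refine (hweight Γ (some φ)
        (by simp only [BoxedIn, Option.mem_some_iff, forall_eq']; tauto) (fun _ h => h)
        ?_).resolve_left fun h => hd (.rOrL h)
      have := four_pow_lt (a := φ.weight) (n := (Form.or φ ψ).weight)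
        (by simp only [Form.weight]; omega)
      simp only [seqWeight, Option.elim_some]
      omega
    · refine (hweight Γ (some ψ)
        (by simp only [BoxedIn, Option.mem_some_iff, forall_eq']; tauto) (fun _ h => h)
        ?_).resolve_left fun h => hd (.rOrR h)
      have := four_pow_lt (a := ψ.weight) (n := (Form.or φ ψ).weight)
        (by simp only [Form.weight]; omega)
      simp only [seqWeight, Option.elim_some]
      omega
  · rintro φ ψ rfl
    simp only [BoxedIn, Form.boxed, Finset.union_subset_iff, Option.mem_some_iff,
      forall_eq'] at hX
    rcases hweight (φ ::ₘ Γ) (some ψ)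
      (by
        simp only [BoxedIn, Multiset.forall_mem_cons, Option.mem_some_iff, forall_eq']
        tauto)
      (by simp +contextual)
      (by
        have := four_pow_add_lt' (a := φ.weight) (b := ψ.weight)
          (n := (Form.imp φ ψ).weight)
          (by simp only [Form.weight]; omega) (by simp only [Form.weight]; omega)
        simp only [seqWeight, Multiset.map_cons, Multiset.sum_cons, Option.elim_some]
        omega) with h | ⟨t, ht, hn⟩
    · exact hd (.rImp h)
    · rw [forcesAll_cons] at ht
      exact hr ⟨t, ht.2, by rintro _ ⟨⟩ h; exact hn ψ rfl (h.mp ht.1)⟩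
  · rintro φ rfl
    have hφ : Form.box φ ∉ Γ := fun h => hd (.of_mem h)
    simp only [BoxedIn, Form.boxed, Finset.insert_subset_iff, Option.mem_some_iff,
      forall_eq'] at hX
    obtain ⟨P, G, hP, rfl⟩ := exists_noBox_add_boxM Γ
    have hG := boxed_subset_of_boxdot hX.1
    rcases hmissing (.box φ ::ₘ (P + boxdot G)) (some φ) φ
      (by
        simp only [BoxedIn, Multiset.forall_mem_cons, Form.boxed,
          Finset.insert_subset_iff, Option.mem_some_iff, forall_eq']
        tauto)
      (by simp +contextual [boxdot, or_imp])
      hX.2.1 hφ (by simp) with h | ⟨t, ht, hn⟩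
    · exact (hd (.rSLa hP h)).elim
    · simp only [forcesAll_cons, forcesAll_add, forcesAll_boxdot] at ht
      refine ⟨t, ⟨forcesAll_add.2 ⟨ht.2.1, ht.2.2.2⟩, fun _ χ hχ => ?_⟩, hn φ rfl⟩
      exact ht.2.2.1 χ ((box_mem_add_boxM hP).1 hχ)

theorem derivable_or_refutable (Γ : Multiset Form) (Δ : Option Form) :
    G4a Γ Δ ∨ Refutable Γ Δ := by
  obtain ⟨X, hX⟩ : ∃ X, BoxedIn X Γ Δ := by
    refine ⟨Γ.toFinset.biUnion Form.boxed ∪ Δ.elim ∅ Form.boxed, fun φ hφ => ?_, ?_⟩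
    · exact (Finset.subset_biUnion_of_mem Form.boxed (Multiset.mem_toFinset.2 hφ)).trans
        Finset.subset_union_left
    · rintro φ rfl
      exact Finset.subset_union_right
  generalize hn : missing X Γ = n
  induction n using Nat.strong_induction_on generalizing Γ Δ with
  | _ n ihn =>
  generalize hk : seqWeight Γ Δ = k
  induction k using Nat.strong_induction_on generalizing Γ Δ with
  | _ k ihk =>
  subst hn hk
  refine derivable_or_refutable_of_smaller hX (fun Γ' Δ' hX' hb hlt => ?_)
    fun Γ' Δ' φ hX' hb hφX hφ hφ' =>
      ihn _ (missing_lt hb hφX hφ hφ') Γ' Δ' hX' rfl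
  rcases (missing_le (X := X) hb).lt_or_eq with h | h
  · exact ihn _ h Γ' Δ' hX' rfl
  · exact ihk _ hlt Γ' Δ' hX' h rfl

/-- the cut rule is admissible in G4iSL□ᵃ. -/
theorem g4a_cut_admissible (Γ₁ Γ₂ : Multiset Form) (φ : Form) (Δ : Option Form)
    (h₁ : G4a Γ₁ (some φ)) (h₂ : G4a (φ ::ₘ Γ₂) Δ) :
    G4a (Γ₁ + Γ₂) Δ := by
  refine (derivable_or_refutable (Γ₁ + Γ₂) Δ).resolve_right ?_
  rintro ⟨t, ht, hΔ⟩
  obtain ⟨χ, hχ, hf⟩ := h₁.sound t fun χ hχ => ht χ (Multiset.mem_add.2 (Or.inl hχ))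
  obtain rfl : φ = χ := by simpa using hχ
  obtain ⟨δ, hδ, hf'⟩ := h₂.sound t (by
    intro χ hχ
    rcases Multiset.mem_cons.1 hχ with rfl | hχ
    · exact hf
    · exact ht χ (Multiset.mem_add.2 (Or.inr hχ)))
  exact hΔ δ hδ hf'
end

section
/- The calculi G3iGLC□ and G3iSL□ are equivalent: a sequent S is derivable in G3iGLC□ if and only if S is derivable in G3iSL□. -/
/-- The sequent calculus G3iSL□ with a height bound:
`G3iSL d Γ Δ` means that the sequent Γ ⇒ Δ has a (cutfree) G3iSL□-derivation
of height at most `d`. -/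
inductive G3iSL : ℕ → Multiset Form → Option Form → Prop
  | axAt {d : ℕ} {Γ : Multiset Form} {p : ℕ} :
      G3iSL (d + 1) (Form.atom p ::ₘ Γ) (some (Form.atom p))
  | axBot {d : ℕ} {Γ : Multiset Form} {Δ : Option Form} :
      G3iSL (d + 1) (Form.bot ::ₘ Γ) Δ
  | rAnd {d : ℕ} {Γ : Multiset Form} {φ ψ : Form} :
      G3iSL d Γ (some φ) → G3iSL d Γ (some ψ) →
      G3iSL (d + 1) Γ (some (Form.and φ ψ))
  | lAnd {d : ℕ} {Γ : Multiset Form} {φ ψ : Form} {Δ : Option Form} :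
      G3iSL d (φ ::ₘ ψ ::ₘ Γ) Δ →
      G3iSL (d + 1) (Form.and φ ψ ::ₘ Γ) Δ
  | rOrL {d : ℕ} {Γ : Multiset Form} {φ ψ : Form} :
      G3iSL d Γ (some φ) → G3iSL (d + 1) Γ (some (Form.or φ ψ))
  | rOrR {d : ℕ} {Γ : Multiset Form} {φ ψ : Form} :
      G3iSL d Γ (some ψ) → G3iSL (d + 1) Γ (some (Form.or φ ψ))
  | lOr {d : ℕ} {Γ : Multiset Form} {φ ψ : Form} {Δ : Option Form} :
      G3iSL d (φ ::ₘ Γ) Δ → G3iSL d (ψ ::ₘ Γ) Δ →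
      G3iSL (d + 1) (Form.or φ ψ ::ₘ Γ) Δ
  | rImp {d : ℕ} {Γ : Multiset Form} {φ ψ : Form} :
      G3iSL d (φ ::ₘ Γ) (some ψ) →
      G3iSL (d + 1) Γ (some (Form.imp φ ψ))
  | lImp {d : ℕ} {Γ : Multiset Form} {φ ψ : Form} {Δ : Option Form} :
      G3iSL d (Form.imp φ ψ ::ₘ Γ) (some φ) → G3iSL d (ψ ::ₘ Γ) Δ →
      G3iSL (d + 1) (Form.imp φ ψ ::ₘ Γ) Δ
  | rSL {d : ℕ} {S P Γ : Multiset Form} {φ : Form} :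
      NoBox P →
      G3iSL d (Form.box φ ::ₘ (P + boxdot Γ)) (some φ) →
      G3iSL (d + 1) (boxM S + P + boxM Γ) (some (Form.box φ))

/-- Derivability in G3iSL□ (some derivation of some height). -/
def G3Der (Γ : Multiset Form) (Δ : Option Form) : Prop := ∃ d, G3iSL d Γ Δ

/-- The sequent calculus G3iGLC□. -/
inductive G3GLC : Multiset Form → Option Form → Prop
  | axAt {Γ : Multiset Form} {p : ℕ} :
      G3GLC (Form.atom p ::ₘ Γ) (some (Form.atom p))
  | axBot {Γ : Multiset Form} {Δ : Option Form} :
      G3GLC (Form.bot ::ₘ Γ) Δ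
  | rAnd {Γ : Multiset Form} {φ ψ : Form} :
      G3GLC Γ (some φ) → G3GLC Γ (some ψ) → G3GLC Γ (some (Form.and φ ψ))
  | lAnd {Γ : Multiset Form} {φ ψ : Form} {Δ : Option Form} :
      G3GLC (φ ::ₘ ψ ::ₘ Γ) Δ → G3GLC (Form.and φ ψ ::ₘ Γ) Δ
  | rOrL {Γ : Multiset Form} {φ ψ : Form} :
      G3GLC Γ (some φ) → G3GLC Γ (some (Form.or φ ψ))
  | rOrR {Γ : Multiset Form} {φ ψ : Form} :
      G3GLC Γ (some ψ) → G3GLC Γ (some (Form.or φ ψ))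
  | lOr {Γ : Multiset Form} {φ ψ : Form} {Δ : Option Form} :
      G3GLC (φ ::ₘ Γ) Δ → G3GLC (ψ ::ₘ Γ) Δ → G3GLC (Form.or φ ψ ::ₘ Γ) Δ
  | rImp {Γ : Multiset Form} {φ ψ : Form} :
      G3GLC (φ ::ₘ Γ) (some ψ) → G3GLC Γ (some (Form.imp φ ψ))
  | lImp {Γ : Multiset Form} {φ ψ : Form} {Δ : Option Form} :
      G3GLC (Form.imp φ ψ ::ₘ Γ) (some φ) → G3GLC (ψ ::ₘ Γ) Δ →
      G3GLC (Form.imp φ ψ ::ₘ Γ) Δ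
  | rGL {S Γ : Multiset Form} {φ : Form} :
      G3GLC (Form.box φ ::ₘ boxdot Γ) (some φ) →
      G3GLC (S + boxM Γ) (some (Form.box φ))
  | lBox {Γ : Multiset Form} {φ : Form} {Δ : Option Form} :
      G3GLC (Form.box φ ::ₘ Γ) Δ → G3GLC (φ ::ₘ Γ) Δ

/-- The formulas a member of the antecedent contributes to the premise of the modal rule. -/
def unbox : Form → Multiset Form
  | Form.box φ => {φ, Form.box φ}
  | φ => {φ}

/-- The antecedent of the premise of the modal rule, apart from the diagonal formula. -/
def unboxM (Γ : Multiset Form) : Multiset Form := Γ.bind unbox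

@[simp] theorem unboxM_zero : unboxM 0 = 0 := Multiset.zero_bind _

@[simp] theorem unboxM_cons (φ : Form) (Γ : Multiset Form) :
    unboxM (φ ::ₘ Γ) = unbox φ + unboxM Γ := Multiset.cons_bind _ _ _

@[simp] theorem unboxM_add (Γ Θ : Multiset Form) :
    unboxM (Γ + Θ) = unboxM Γ + unboxM Θ := Multiset.add_bind _ _ _

theorem singleton_le_unbox (φ : Form) : {φ} ≤ unbox φ := by
  cases φ <;> simp [unbox]

theorem le_unboxM (Γ : Multiset Form) : Γ ≤ unboxM Γ := by
  induction Γ using Multiset.induction_on with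
  | empty => simp
  | cons φ Γ ih =>
    rw [unboxM_cons, ← Multiset.singleton_add]
    exact add_le_add (singleton_le_unbox φ) ih

theorem unboxM_boxM (Γ : Multiset Form) : unboxM (boxM Γ) = boxdot Γ := by
  induction Γ using Multiset.induction_on with
  | empty => simp [boxM, boxdot]
  | cons φ Γ ih =>
    simp only [boxM, boxdot, Multiset.map_cons, unboxM_cons, unbox] at ih ⊢
    rw [ih]
    simp only [← Multiset.singleton_add, Multiset.insert_eq_cons]
    abel

theorem exists_noBox_decomposition (Γ : Multiset Form) :
    ∃ P G, NoBox P ∧ Γ = P + boxM G ∧ unboxM Γ = P + boxdot G := by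
  induction Γ using Multiset.induction_on with
  | empty => exact ⟨0, 0, by simp [NoBox], by simp [boxM], by simp [boxM, boxdot]⟩
  | cons φ Γ ih =>
    obtain ⟨P, G, hP, hΓ, hU⟩ := ih
    by_cases hφ : ∃ ψ, φ = Form.box ψ
    · obtain ⟨ψ, rfl⟩ := hφ
      refine ⟨P, ψ ::ₘ G, hP, by simp [hΓ, boxM], ?_⟩
      rw [unboxM_cons, hU]
      simp only [unbox, boxdot, boxM, Multiset.map_cons]
      simp only [← Multiset.singleton_add, Multiset.insert_eq_cons]
      abel
    · refine ⟨φ ::ₘ P, G, ?_, by simp [hΓ], ?_⟩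
      · intro χ hχ ψ hψ
        rcases Multiset.mem_cons.1 hχ with rfl | hχ
        · exact hφ ⟨ψ, hψ⟩
        · exact hP χ hχ ψ hψ
      · have : unbox φ = {φ} := by
          cases φ <;> first | rfl | exact absurd ⟨_, rfl⟩ hφ
        rw [unboxM_cons, hU, this]
        simp

/-- The variant of `G3iSL` in which the modal rule unboxes the whole antecedent. -/
inductive UnboxDer : ℕ → Multiset Form → Option Form → Prop
  | axAt {d : ℕ} {Γ : Multiset Form} {p : ℕ} :
      UnboxDer (d + 1) (Form.atom p ::ₘ Γ) (some (Form.atom p))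
  | axBot {d : ℕ} {Γ : Multiset Form} {Δ : Option Form} :
      UnboxDer (d + 1) (Form.bot ::ₘ Γ) Δ
  | rAnd {d : ℕ} {Γ : Multiset Form} {φ ψ : Form} :
      UnboxDer d Γ (some φ) → UnboxDer d Γ (some ψ) →
      UnboxDer (d + 1) Γ (some (Form.and φ ψ))
  | lAnd {d : ℕ} {Γ : Multiset Form} {φ ψ : Form} {Δ : Option Form} :
      UnboxDer d (φ ::ₘ ψ ::ₘ Γ) Δ →
      UnboxDer (d + 1) (Form.and φ ψ ::ₘ Γ) Δ
  | rOrL {d : ℕ} {Γ : Multiset Form} {φ ψ : Form} :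
      UnboxDer d Γ (some φ) → UnboxDer (d + 1) Γ (some (Form.or φ ψ))
  | rOrR {d : ℕ} {Γ : Multiset Form} {φ ψ : Form} :
      UnboxDer d Γ (some ψ) → UnboxDer (d + 1) Γ (some (Form.or φ ψ))
  | lOr {d : ℕ} {Γ : Multiset Form} {φ ψ : Form} {Δ : Option Form} :
      UnboxDer d (φ ::ₘ Γ) Δ → UnboxDer d (ψ ::ₘ Γ) Δ →
      UnboxDer (d + 1) (Form.or φ ψ ::ₘ Γ) Δ
  | rImp {d : ℕ} {Γ : Multiset Form} {φ ψ : Form} :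
      UnboxDer d (φ ::ₘ Γ) (some ψ) →
      UnboxDer (d + 1) Γ (some (Form.imp φ ψ))
  | lImp {d : ℕ} {Γ : Multiset Form} {φ ψ : Form} {Δ : Option Form} :
      UnboxDer d (Form.imp φ ψ ::ₘ Γ) (some φ) → UnboxDer d (ψ ::ₘ Γ) Δ →
      UnboxDer (d + 1) (Form.imp φ ψ ::ₘ Γ) Δ
  | rBox {d : ℕ} {Γ : Multiset Form} {φ : Form} :
      UnboxDer d (Form.box φ ::ₘ unboxM Γ) (some φ) →
      UnboxDer (d + 1) Γ (some (Form.box φ))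

namespace UnboxDer

theorem toG3iSL {d : ℕ} {Γ : Multiset Form} {Δ : Option Form} (h : UnboxDer d Γ Δ) :
    G3iSL d Γ Δ := by
  induction h with
  | axAt => exact .axAt
  | axBot => exact .axBot
  | rAnd _ _ ih₁ ih₂ => exact .rAnd ih₁ ih₂
  | lAnd _ ih => exact .lAnd ih
  | rOrL _ ih => exact .rOrL ih
  | rOrR _ ih => exact .rOrR ih
  | lOr _ _ ih₁ ih₂ => exact .lOr ih₁ ih₂
  | rImp _ ih => exact .rImp ih
  | lImp _ _ ih₁ ih₂ => exact .lImp ih₁ ih₂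
  | @rBox d Γ φ _ ih =>
    obtain ⟨P, G, hP, hΓ, hU⟩ := exists_noBox_decomposition Γ
    rw [hU] at ih
    have := G3iSL.rSL (S := 0) hP ih
    rwa [boxM, Multiset.map_zero, zero_add, ← hΓ] at this

theorem add_right {d : ℕ} {Γ : Multiset Form} {Δ : Option Form} (h : UnboxDer d Γ Δ)
    (Θ : Multiset Form) : UnboxDer d (Γ + Θ) Δ := by
  induction h generalizing Θ with
  | axAt => rw [Multiset.cons_add]; exact .axAt
  | axBot => rw [Multiset.cons_add]; exact .axBot
  | rAnd _ _ ih₁ ih₂ => exact .rAnd (ih₁ Θ) (ih₂ Θ)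
  | lAnd _ ih => simpa using UnboxDer.lAnd (by simpa using ih Θ)
  | rOrL _ ih => exact .rOrL (ih Θ)
  | rOrR _ ih => exact .rOrR (ih Θ)
  | lOr _ _ ih₁ ih₂ =>
    simpa using UnboxDer.lOr (by simpa using ih₁ Θ) (by simpa using ih₂ Θ)
  | rImp _ ih => exact .rImp (by simpa using ih Θ)
  | lImp _ _ ih₁ ih₂ =>
    simpa using UnboxDer.lImp (by simpa using ih₁ Θ) (by simpa using ih₂ Θ)
  | rBox _ ih => exact .rBox (by simpa using ih (unboxM Θ))

theorem weaken {d : ℕ} {Γ Γ' : Multiset Form} {Δ : Option Form} (h : UnboxDer d Γ Δ)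
    (hΓ : Γ ≤ Γ') : UnboxDer d Γ' Δ := by
  obtain ⟨Θ, rfl⟩ := Multiset.le_iff_exists_add.1 hΓ
  exact h.add_right Θ

theorem succ {d : ℕ} {Γ : Multiset Form} {Δ : Option Form} (h : UnboxDer d Γ Δ) :
    UnboxDer (d + 1) Γ Δ := by
  induction h with
  | axAt => exact .axAt
  | axBot => exact .axBot
  | rAnd _ _ ih₁ ih₂ => exact .rAnd ih₁ ih₂
  | lAnd _ ih => exact .lAnd ih
  | rOrL _ ih => exact .rOrL ih
  | rOrR _ ih => exact .rOrR ih
  | lOr _ _ ih₁ ih₂ => exact .lOr ih₁ ih₂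
  | rImp _ ih => exact .rImp ih
  | lImp _ _ ih₁ ih₂ => exact .lImp ih₁ ih₂
  | rBox _ ih => exact .rBox ih

theorem mono {d e : ℕ} {Γ : Multiset Form} {Δ : Option Form} (h : UnboxDer d Γ Δ)
    (hde : d ≤ e) : UnboxDer e Γ Δ := by
  induction hde with
  | refl => exact h
  | step _ ih => exact ih.succ

end UnboxDer

/-- `LeftInv χ Θ` holds if replacing `χ` by `Θ` in the antecedent is an inversion of a
left rule. -/
inductive LeftInv : Form → Multiset Form → Prop
  | and {φ ψ : Form} : LeftInv (Form.and φ ψ) {φ, ψ}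
  | orL {φ ψ : Form} : LeftInv (Form.or φ ψ) {φ}
  | orR {φ ψ : Form} : LeftInv (Form.or φ ψ) {ψ}
  | imp {φ ψ : Form} : LeftInv (Form.imp φ ψ) {ψ}

theorem LeftInv.unbox_eq {χ : Form} {Θ : Multiset Form} (h : LeftInv χ Θ) :
    unbox χ = {χ} := by
  cases h <;> rfl

namespace UnboxDer

/-- Height-preserving invertibility of the left rules. -/
theorem invert {d : ℕ} {Γ Γ' Θ : Multiset Form} {Δ : Option Form} {χ : Form}
    (hχ : LeftInv χ Θ) (h : UnboxDer d Γ Δ) (hΓ : Γ = χ ::ₘ Γ') :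
    UnboxDer d (Γ' + Θ) Δ := by
  induction h generalizing Γ' with
  | axAt =>
    rcases Multiset.cons_eq_cons.1 hΓ with ⟨rfl, rfl⟩ | ⟨_, Λ, rfl, rfl⟩
    · cases hχ
    · rw [Multiset.cons_add]; exact .axAt
  | axBot =>
    rcases Multiset.cons_eq_cons.1 hΓ with ⟨rfl, rfl⟩ | ⟨_, Λ, rfl, rfl⟩
    · cases hχ
    · rw [Multiset.cons_add]; exact .axBot
  | rAnd _ _ ih₁ ih₂ => exact .rAnd (ih₁ hΓ) (ih₂ hΓ)
  | @lAnd d Γ φ ψ Δ h ih =>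
    rcases Multiset.cons_eq_cons.1 hΓ with ⟨rfl, rfl⟩ | ⟨_, Λ, rfl, rfl⟩
    · cases hχ
      refine h.succ.weaken (le_of_eq ?_)
      simp only [← Multiset.singleton_add, Multiset.insert_eq_cons]
      abel
    · rw [Multiset.cons_add]
      refine .lAnd ?_
      simpa using ih (Γ' := φ ::ₘ ψ ::ₘ Λ) (by simp only [← Multiset.singleton_add]; abel)
  | rOrL _ ih => exact .rOrL (ih hΓ)
  | rOrR _ ih => exact .rOrR (ih hΓ)
  | @lOr d Γ φ ψ Δ h₁ h₂ ih₁ ih₂ =>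
    rcases Multiset.cons_eq_cons.1 hΓ with ⟨rfl, rfl⟩ | ⟨_, Λ, rfl, rfl⟩
    · cases hχ
      · exact h₁.succ.weaken (by rw [add_comm, Multiset.singleton_add])
      · exact h₂.succ.weaken (by rw [add_comm, Multiset.singleton_add])
    · rw [Multiset.cons_add]
      refine .lOr ?_ ?_
      · simpa using ih₁ (Γ' := φ ::ₘ Λ) (Multiset.cons_swap _ _ _)
      · simpa using ih₂ (Γ' := ψ ::ₘ Λ) (Multiset.cons_swap _ _ _)
  | @rImp d Γ φ ψ _ ih =>
    refine .rImp ?_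
    simpa using ih (Γ' := φ ::ₘ Γ') (by rw [hΓ, Multiset.cons_swap])
  | @lImp d Γ φ ψ Δ h₁ h₂ ih₁ ih₂ =>
    rcases Multiset.cons_eq_cons.1 hΓ with ⟨rfl, rfl⟩ | ⟨_, Λ, rfl, rfl⟩
    · cases hχ
      exact h₂.succ.weaken (by rw [add_comm, Multiset.singleton_add])
    · rw [Multiset.cons_add]
      refine .lImp ?_ ?_
      · simpa using ih₁ (Γ' := Form.imp φ ψ ::ₘ Λ) (Multiset.cons_swap _ _ _)
      · simpa using ih₂ (Γ' := ψ ::ₘ Λ) (Multiset.cons_swap _ _ _)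
  | @rBox d Γ φ _ ih =>
    subst hΓ
    have := ih (Γ' := Form.box φ ::ₘ unboxM Γ') (by
      rw [unboxM_cons, hχ.unbox_eq, Multiset.singleton_add, Multiset.cons_swap])
    refine .rBox (this.weaken ?_)
    rw [unboxM_add, Multiset.cons_add]
    exact Multiset.cons_le_cons _ (add_le_add_right (le_unboxM Θ) _)

theorem contract_add {d : ℕ}
    (contr : ∀ {Γ : Multiset Form} {Δ : Option Form} {χ : Form},
      UnboxDer d (χ ::ₘ χ ::ₘ Γ) Δ → UnboxDer d (χ ::ₘ Γ) Δ)
    {Γ : Multiset Form} {Δ : Option Form} (Θ : Multiset Form)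
    (h : UnboxDer d (Θ + Θ + Γ) Δ) : UnboxDer d (Θ + Γ) Δ := by
  induction Θ using Multiset.induction_on generalizing Γ with
  | empty => simpa using h
  | cons φ Θ ih =>
    rw [Multiset.cons_add]
    refine contr ?_
    have := ih (Γ := φ ::ₘ φ ::ₘ Γ) (by
      convert h using 1
      simp only [← Multiset.singleton_add]
      abel)
    simpa using this

/-- Height-preserving admissibility of contraction. -/
theorem contract {d : ℕ} {Γ : Multiset Form} {Δ : Option Form} {χ : Form}
    (h : UnboxDer d (χ ::ₘ χ ::ₘ Γ) Δ) : UnboxDer d (χ ::ₘ Γ) Δ := by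
  induction d generalizing Γ Δ χ with
  | zero => cases h
  | succ d ih =>
    have ihM := fun {Γ Δ} Θ => contract_add (Γ := Γ) (Δ := Δ) ih Θ
    generalize hΞ : χ ::ₘ χ ::ₘ Γ = Ξ at h
    -- a second principal formula equal to the first is inverted, then contracted away
    have split : ∀ {a : Form} {Λ : Multiset Form}, χ ::ₘ χ ::ₘ Γ = a ::ₘ Λ →
        (χ = a ∧ Λ = a ::ₘ Γ) ∨ ∃ M, Γ = a ::ₘ M ∧ Λ = χ ::ₘ χ ::ₘ M := by
      intro a Λ e
      rcases Multiset.cons_eq_cons.1 e with ⟨rfl, rfl⟩ | ⟨hne, M, e', rfl⟩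
      · exact .inl ⟨rfl, rfl⟩
      · rcases Multiset.cons_eq_cons.1 e' with ⟨rfl, rfl⟩ | ⟨_, N, rfl, rfl⟩
        · exact absurd rfl hne
        · exact .inr ⟨N, rfl, rfl⟩
    cases h with
    | axAt =>
      rcases split hΞ with ⟨rfl, rfl⟩ | ⟨M, rfl, rfl⟩
      · exact .axAt
      · rw [Multiset.cons_swap]; exact .axAt
    | axBot =>
      rcases split hΞ with ⟨rfl, rfl⟩ | ⟨M, rfl, rfl⟩
      · exact .axBot
      · rw [Multiset.cons_swap]; exact .axBot
    | rAnd h₁ h₂ => subst hΞ; exact .rAnd (ih h₁) (ih h₂)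
    | @lAnd _ _ φ ψ _ h =>
      rcases split hΞ with ⟨rfl, rfl⟩ | ⟨M, rfl, rfl⟩
      · refine .lAnd ?_
        have := invert (Γ' := φ ::ₘ ψ ::ₘ Γ) LeftInv.and h
          (by simp only [← Multiset.singleton_add]; abel)
        have := ihM (Γ := Γ) {φ, ψ} (by
          convert this using 1
          simp only [← Multiset.singleton_add, Multiset.insert_eq_cons]
          abel)
        simpa using this
      · rw [Multiset.cons_swap]
        refine .lAnd ?_
        have := ih (χ := χ) (Γ := φ ::ₘ ψ ::ₘ M) (by
          convert h using 1
          simp only [← Multiset.singleton_add]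
          abel)
        convert this using 1
        simp only [← Multiset.singleton_add]
        abel
    | rOrL h => subst hΞ; exact .rOrL (ih h)
    | rOrR h => subst hΞ; exact .rOrR (ih h)
    | @lOr _ _ φ ψ _ h₁ h₂ =>
      rcases split hΞ with ⟨rfl, rfl⟩ | ⟨M, rfl, rfl⟩
      · refine .lOr (ih ?_) (ih ?_)
        · have := invert (Γ' := φ ::ₘ Γ) LeftInv.orL h₁ (Multiset.cons_swap _ _ _)
          rwa [add_comm, Multiset.singleton_add] at this
        · have := invert (Γ' := ψ ::ₘ Γ) LeftInv.orR h₂ (Multiset.cons_swap _ _ _)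
          rwa [add_comm, Multiset.singleton_add] at this
      · rw [Multiset.cons_swap]
        refine .lOr ?_ ?_
        · rw [Multiset.cons_swap]
          refine ih ?_
          rwa [Multiset.cons_swap χ φ, Multiset.cons_swap χ φ]
        · rw [Multiset.cons_swap]
          refine ih ?_
          rwa [Multiset.cons_swap χ ψ, Multiset.cons_swap χ ψ]
    | @rImp _ _ φ ψ h =>
      subst hΞ
      refine .rImp ?_
      rw [Multiset.cons_swap]
      refine ih ?_
      rwa [Multiset.cons_swap χ φ, Multiset.cons_swap χ φ]
    | @lImp _ _ φ ψ _ h₁ h₂ =>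
      rcases split hΞ with ⟨rfl, rfl⟩ | ⟨M, rfl, rfl⟩
      · refine .lImp (ih h₁) (ih ?_)
        have := invert (Γ' := ψ ::ₘ Γ) LeftInv.imp h₂ (Multiset.cons_swap _ _ _)
        rwa [add_comm, Multiset.singleton_add] at this
      · rw [Multiset.cons_swap]
        refine .lImp ?_ ?_
        · rw [Multiset.cons_swap]
          refine ih ?_
          rwa [Multiset.cons_swap χ (φ.imp ψ), Multiset.cons_swap χ (φ.imp ψ)]
        · rw [Multiset.cons_swap]
          refine ih ?_
          rwa [Multiset.cons_swap χ ψ, Multiset.cons_swap χ ψ]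
    | @rBox _ _ φ h =>
      subst hΞ
      refine .rBox ?_
      have := ihM (Γ := Form.box φ ::ₘ unboxM Γ) (unbox χ) (by
        convert h using 1
        rw [unboxM_cons, unboxM_cons]
        simp only [← Multiset.singleton_add]
        abel)
      simpa using this

/-- Height-preserving admissibility of the left box rule of `G3GLC`. -/
theorem lBox {d : ℕ} {Γ Γ' : Multiset Form} {Δ : Option Form} {χ : Form}
    (h : UnboxDer d Γ' Δ) (hΓ : Γ' = Form.box χ ::ₘ Γ) : UnboxDer d (χ ::ₘ Γ) Δ := by
  induction h generalizing Γ with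
  | axAt =>
    obtain ⟨h, -⟩ | ⟨_, Λ, rfl, rfl⟩ := Multiset.cons_eq_cons.1 hΓ
    · cases h
    · rw [Multiset.cons_swap]; exact .axAt
  | axBot =>
    obtain ⟨h, -⟩ | ⟨_, Λ, rfl, rfl⟩ := Multiset.cons_eq_cons.1 hΓ
    · cases h
    · rw [Multiset.cons_swap]; exact .axBot
  | rAnd _ _ ih₁ ih₂ => exact .rAnd (ih₁ hΓ) (ih₂ hΓ)
  | @lAnd d Γ φ ψ Δ _ ih =>
    obtain ⟨h, -⟩ | ⟨_, Λ, rfl, rfl⟩ := Multiset.cons_eq_cons.1 hΓ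
    · cases h
    · rw [Multiset.cons_swap]
      refine .lAnd ?_
      rw [Multiset.cons_swap ψ χ, Multiset.cons_swap φ χ]
      exact ih (by simp only [← Multiset.singleton_add]; abel)
  | rOrL _ ih => exact .rOrL (ih hΓ)
  | rOrR _ ih => exact .rOrR (ih hΓ)
  | lOr _ _ ih₁ ih₂ =>
    obtain ⟨h, -⟩ | ⟨_, Λ, rfl, rfl⟩ := Multiset.cons_eq_cons.1 hΓ
    · cases h
    · rw [Multiset.cons_swap]
      refine .lOr ?_ ?_
      · rw [Multiset.cons_swap]; exact ih₁ (Multiset.cons_swap _ _ _)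
      · rw [Multiset.cons_swap]; exact ih₂ (Multiset.cons_swap _ _ _)
  | rImp _ ih =>
    refine .rImp ?_
    rw [Multiset.cons_swap]
    exact ih (by rw [hΓ, Multiset.cons_swap])
  | lImp _ _ ih₁ ih₂ =>
    obtain ⟨h, -⟩ | ⟨_, Λ, rfl, rfl⟩ := Multiset.cons_eq_cons.1 hΓ
    · cases h
    · rw [Multiset.cons_swap]
      refine .lImp ?_ ?_
      · rw [Multiset.cons_swap]; exact ih₁ (Multiset.cons_swap _ _ _)
      · rw [Multiset.cons_swap]; exact ih₂ (Multiset.cons_swap _ _ _)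
  | @rBox d _ φ _ ih =>
    subst hΓ
    have := ih (Γ := χ ::ₘ Form.box φ ::ₘ unboxM Γ) (by
      simp only [unboxM_cons, unbox]
      simp only [← Multiset.singleton_add, Multiset.insert_eq_cons]
      abel)
    refine .rBox (this.contract.weaken ?_)
    rw [Multiset.cons_swap, unboxM_cons, ← Multiset.singleton_add χ]
    exact Multiset.cons_le_cons _ (add_le_add_left (singleton_le_unbox χ) _)

end UnboxDer

namespace G3GLC

theorem toUnboxDer {Γ : Multiset Form} {Δ : Option Form} (h : G3GLC Γ Δ) :
    ∃ d, UnboxDer d Γ Δ := by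
  induction h with
  | axAt => exact ⟨1, .axAt⟩
  | axBot => exact ⟨1, .axBot⟩
  | rAnd _ _ ih₁ ih₂ =>
    obtain ⟨d, h₁⟩ := ih₁
    obtain ⟨e, h₂⟩ := ih₂
    exact ⟨_, .rAnd (h₁.mono (le_max_left d e)) (h₂.mono (le_max_right d e))⟩
  | lAnd _ ih => exact ih.imp' _ fun _ => .lAnd
  | rOrL _ ih => exact ih.imp' _ fun _ => .rOrL
  | rOrR _ ih => exact ih.imp' _ fun _ => .rOrR
  | lOr _ _ ih₁ ih₂ =>
    obtain ⟨d, h₁⟩ := ih₁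
    obtain ⟨e, h₂⟩ := ih₂
    exact ⟨_, .lOr (h₁.mono (le_max_left d e)) (h₂.mono (le_max_right d e))⟩
  | rImp _ ih => exact ih.imp' _ fun _ => .rImp
  | lImp _ _ ih₁ ih₂ =>
    obtain ⟨d, h₁⟩ := ih₁
    obtain ⟨e, h₂⟩ := ih₂
    exact ⟨_, .lImp (h₁.mono (le_max_left d e)) (h₂.mono (le_max_right d e))⟩
  | @rGL S G φ _ ih =>
    obtain ⟨d, h⟩ := ih
    refine ⟨d + 1, .rBox (h.weaken (Multiset.cons_le_cons _ ?_))⟩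
    rw [unboxM_add, unboxM_boxM]
    exact Multiset.le_add_left _ _
  | lBox _ ih =>
    obtain ⟨d, h⟩ := ih
    exact ⟨d, h.lBox rfl⟩

theorem add_right {Γ : Multiset Form} {Δ : Option Form} (h : G3GLC Γ Δ)
    (Θ : Multiset Form) : G3GLC (Γ + Θ) Δ := by
  induction h with
  | axAt => rw [Multiset.cons_add]; exact .axAt
  | axBot => rw [Multiset.cons_add]; exact .axBot
  | rAnd _ _ ih₁ ih₂ => exact .rAnd ih₁ ih₂
  | lAnd _ ih => simpa using G3GLC.lAnd (by simpa using ih)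
  | rOrL _ ih => exact .rOrL ih
  | rOrR _ ih => exact .rOrR ih
  | lOr _ _ ih₁ ih₂ => simpa using G3GLC.lOr (by simpa using ih₁) (by simpa using ih₂)
  | rImp _ ih => exact .rImp (by simpa using ih)
  | lImp _ _ ih₁ ih₂ => simpa using G3GLC.lImp (by simpa using ih₁) (by simpa using ih₂)
  | rGL h _ => rw [add_right_comm]; exact .rGL h
  | lBox _ ih => simpa using G3GLC.lBox (by simpa using ih)

theorem of_boxM_add {Γ : Multiset Form} {Δ : Option Form} (P : Multiset Form)
    (h : G3GLC (boxM P + Γ) Δ) : G3GLC (P + Γ) Δ := by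
  induction P using Multiset.induction_on generalizing Γ with
  | empty => simpa [boxM] using h
  | cons φ P ih =>
    rw [Multiset.cons_add]
    refine .lBox ?_
    simpa using ih (Γ := Form.box φ ::ₘ Γ) (by simpa [boxM] using h)

end G3GLC

theorem G3iSL.toG3GLC {d : ℕ} {Γ : Multiset Form} {Δ : Option Form} (h : G3iSL d Γ Δ) :
    G3GLC Γ Δ := by
  induction h with
  | axAt => exact .axAt
  | axBot => exact .axBot
  | rAnd _ _ ih₁ ih₂ => exact .rAnd ih₁ ih₂
  | lAnd _ ih => exact .lAnd ih
  | rOrL _ ih => exact .rOrL ih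
  | rOrR _ ih => exact .rOrR ih
  | lOr _ _ ih₁ ih₂ => exact .lOr ih₁ ih₂
  | rImp _ ih => exact .rImp ih
  | lImp _ _ ih₁ ih₂ => exact .lImp ih₁ ih₂
  | @rSL d S P G φ _ _ ih =>
    have hbox : G3GLC (boxM S + boxM (P + G)) (some (Form.box φ)) := by
      refine .rGL ?_
      convert ih.add_right (boxM P) using 1
      simp only [boxdot, boxM, Multiset.map_add, ← Multiset.singleton_add]
      abel
    have := G3GLC.of_boxM_add P (Γ := boxM S + boxM G) (by
      convert hbox using 1
      simp only [boxM, Multiset.map_add]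
      abel)
    rwa [add_comm (boxM S) P, add_assoc]

/-- G3iGLC□ and G3iSL□ derive the same sequents. -/
theorem g3iglc_equiv_g3isl (Γ : Multiset Form) (Δ : Option Form) :
    G3GLC Γ Δ ↔ G3Der Γ Δ := by
  refine ⟨fun h => ?_, fun ⟨_, h⟩ => h.toG3GLC⟩
  obtain ⟨d, h⟩ := h.toUnboxDer
  exact ⟨d, h.toG3iSL⟩
end
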